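/- Let β > 0, ρ ∈ [0, 1/2], μ ∈ (0, 2π]. For k ∈ ℕ and 0 ≤ s ≤ k set v_{k,s}(θ) = C(β, k)·C(k, s)·(1/(2π))^(β−k)·(ρ/π)^k·θ^(β−k)·(2·cos(θ − μ)² − 1)·[ (sin μ)^s·(sin(θ − μ))^(k−s)·M₀(θ) + (sin μ)^(k−s)·(sin(θ − μ))^s·M₁(θ) ], where M₀(θ) = 1 if |sin(θ − μ)| ≥ |sin(μ)| and 0 otherwise, and M₁ = 1 − M₀. Assume each v_{k,s} is integrable on (0, 2π) and ∑_{k=0}^∞ ∑_{s=0}^{k} ∫₀^{2π} |v_{k,s}(θ)| dθ < ∞. Then the second sine moment satisfies β₂ := ∫₀^{2π} sin(2(θ − μ))·f(θ) dθ = −sin(2μ) − 2·∑_{k=0}^∞ ∑_{s=0}^{k} ∫₀^{2π} v_{k,s}(θ) dθ. -/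

import Mathlib

open Real MeasureTheory

/-- Generalized binomial coefficient `C(β, k) = β (β-1) ⋯ (β-k+1) / k!`. -/
noncomputable def genBinom (β : ℝ) (k : ℕ) : ℝ :=
  (∏ i ∈ Finset.range k, (β - i)) / (Nat.factorial k)

theorem ec_genBinom_eq (β : ℝ) (k : ℕ) : genBinom β k = Ring.choose β k := by
  rw [Ring.choose_eq_smul, genBinom, Polynomial.descPochhammer_smeval_eq_ascPochhammer,
    Polynomial.ascPochhammer_smeval_eq_eval, ← descPochhammer_eval_eq_ascPochhammer,
    descPochhammer_eval_eq_prod_range, smul_eq_mul, div_eq_inv_mul]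

theorem ec_binom_hasSum (β x : ℝ) (hx : |x| < 1) :
    HasSum (fun k : ℕ => genBinom β k * x ^ k) ((1 + x) ^ β) := by
  have h := (Real.one_add_rpow_hasFPowerSeriesOnBall_zero (a := β)).hasSum (y := x)
    (by simpa [enorm_eq_nnnorm, ← NNReal.coe_lt_coe] using hx)
  simp only [zero_add, binomialSeries_apply, smul_eq_mul, List.ofFn_const, List.prod_replicate] at h
  simpa only [ec_genBinom_eq] using h

theorem ec_binom_hasSum' (β a b : ℝ) (hab : |b| < a) :
    HasSum (fun k : ℕ => genBinom β k * a ^ (β - (k : ℝ)) * b ^ k) ((a + b) ^ β) := by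
  have ha : 0 < a := (abs_nonneg b).trans_lt hab
  have hx : |b / a| < 1 := by rw [abs_div, abs_of_pos ha, div_lt_one ha]; exact hab
  have h := (ec_binom_hasSum β (b / a) hx).mul_left (a ^ β)
  have h1 : 0 ≤ 1 + b / a := by linarith [(abs_lt.1 hx).1]
  rw [← Real.mul_rpow ha.le h1, mul_add, mul_one, mul_div_cancel₀ _ ha.ne'] at h
  refine Eq.mp (congrArg (fun f => HasSum f ((a + b) ^ β)) (funext fun k => ?_)) h
  rw [Real.rpow_sub ha, Real.rpow_natCast, div_pow]
  ring

theorem ec_bound (ρ μ θ : ℝ) (hρ0 : 0 ≤ ρ) (hρ1 : ρ ≤ 1 / 2) (hθ : 0 < θ) :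
    |(ρ / π) * (Real.sin (θ - μ) + Real.sin μ)| < θ / (2 * π) := by
  have h1 : Real.sin (θ - μ) + Real.sin μ = 2 * Real.sin (θ / 2) * Real.cos (θ / 2 - μ) := by
    have := Real.sin_sub_sin (θ - μ) (-μ)
    rw [Real.sin_neg, sub_neg_eq_add] at this
    rw [this]; congr 2 <;> ring_nf
  have h2 : |Real.sin (θ - μ) + Real.sin μ| < θ := by
    rw [h1, abs_mul, abs_mul, abs_two]
    have h3 : |Real.sin (θ / 2)| < θ / 2 := by
      have := Real.abs_sin_lt_abs (x := θ / 2) (by positivity)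
      rwa [abs_of_pos (by positivity : 0 < θ / 2)] at this
    have h4 := Real.abs_cos_le_one (θ / 2 - μ)
    nlinarith [abs_nonneg (Real.sin (θ / 2)), abs_nonneg (Real.cos (θ / 2 - μ))]
  rw [abs_mul, abs_of_nonneg (by positivity : 0 ≤ ρ / π), div_mul_eq_mul_div,
    div_lt_div_iff₀ pi_pos (by positivity)]
  have h5 : ρ * |Real.sin (θ - μ) + Real.sin μ| * 2 < θ := by
    nlinarith [abs_nonneg (Real.sin (θ - μ) + Real.sin μ)]
  nlinarith [pi_pos]

theorem ec_second_sin_moment (β ρ μ : ℝ) (hβ : 0 < β) (hρ0 : 0 ≤ ρ) (hρ1 : ρ ≤ 1 / 2)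
    (hμ0 : 0 < μ) (hμ1 : μ ≤ 2 * π) (v : ℕ → ℕ → ℝ → ℝ)
    (hv : ∀ k s : ℕ, s ≤ k → ∀ θ : ℝ,
      v k s θ = genBinom β k * (Nat.choose k s : ℝ) * (1 / (2 * π)) ^ (β - (k : ℝ)) *
        (ρ / π) ^ k * θ ^ (β - (k : ℝ)) * (2 * Real.cos (θ - μ) ^ 2 - 1) *
        ((Real.sin μ) ^ s * (Real.sin (θ - μ)) ^ (k - s) *
            (if |Real.sin (θ - μ)| ≥ |Real.sin μ| then (1 : ℝ) else 0) +
          (Real.sin μ) ^ (k - s) * (Real.sin (θ - μ)) ^ s *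
            (1 - if |Real.sin (θ - μ)| ≥ |Real.sin μ| then (1 : ℝ) else 0)))
    (hint : ∀ k s : ℕ, s ≤ k → IntegrableOn (v k s) (Set.Ioo 0 (2 * π)) volume)
    (hsum : Summable fun k : ℕ =>
      ∑ s ∈ Finset.range (k + 1), ∫ θ in (0 : ℝ)..(2 * π), |v k s θ|) :
    ∫ θ in (0 : ℝ)..(2 * π),
        Real.sin (2 * (θ - μ)) *
          ((β / (2 * π)) *
            (θ / (2 * π) + (ρ / π) * (Real.sin (θ - μ) + Real.sin μ)) ^ (β - 1) *
            (1 + 2 * ρ * Real.cos (θ - μ))) =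
      -Real.sin (2 * μ) -
        2 * ∑' k : ℕ, ∑ s ∈ Finset.range (k + 1), ∫ θ in (0 : ℝ)..(2 * π), v k s θ := by 
  have h2π : (0 : ℝ) < 2 * π := by positivity
  set G : ℝ → ℝ := fun θ => θ / (2 * π) + (ρ / π) * (Real.sin (θ - μ) + Real.sin μ) with hG
  have hGpos : ∀ θ, 0 < θ → 0 < G θ := fun θ hθ => by
    have := (abs_lt.1 (ec_bound ρ μ θ hρ0 hρ1 hθ)).1
    simp only [hG]; linarith
  have hGcont : Continuous G := by fun_prop
  have hG0 : G 0 = 0 := by simp [hG]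
  have hG1 : G (2 * π) = 1 := by
    simp only [hG]
    rw [show 2 * π - μ = -μ + 2 * π by ring, Real.sin_add_two_pi, Real.sin_neg]
    field_simp; ring
  have hGder : ∀ θ, HasDerivAt G (1 / (2 * π) * (1 + 2 * ρ * Real.cos (θ - μ))) θ := fun θ => by
    have h1 : HasDerivAt (fun θ => Real.sin (θ - μ)) (Real.cos (θ - μ) * 1) θ :=
      ((hasDerivAt_id θ).sub_const μ).sin
    refine (((hasDerivAt_id' θ).div_const (2 * π)).add
      ((h1.add_const (Real.sin μ)).const_mul (ρ / π))).congr_deriv ?_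
    field_simp
  -- the cdf
  have hFcont : Continuous fun θ => G θ ^ β := hGcont.rpow_const fun _ => Or.inr hβ.le
  have hFder : ∀ θ ∈ Set.Ioo (min 0 (2 * π)) (max 0 (2 * π)), HasDerivAt (fun θ => G θ ^ β)
      ((β / (2 * π)) * G θ ^ (β - 1) * (1 + 2 * ρ * Real.cos (θ - μ))) θ := fun θ hθ => by
    rw [min_eq_left h2π.le, max_eq_right h2π.le] at hθ
    convert (hGder θ).rpow_const (p := β) (Or.inl (hGpos θ hθ.1).ne') using 1
    ring
  have hfint : IntervalIntegrable
      (fun θ => (β / (2 * π)) * G θ ^ (β - 1) * (1 + 2 * ρ * Real.cos (θ - μ)))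
      volume 0 (2 * π) := by
    refine intervalIntegral.intervalIntegrable_deriv_of_nonneg hFcont.continuousOn hFder ?_
    intro θ hθ
    rw [min_eq_left h2π.le, max_eq_right h2π.le] at hθ
    have h1 : 0 ≤ 1 + 2 * ρ * Real.cos (θ - μ) := by
      nlinarith [Real.neg_one_le_cos (θ - μ)]
    have h2 := Real.rpow_nonneg (hGpos θ hθ.1).le (β - 1)
    positivity
  have hsder : ∀ θ, HasDerivAt (fun θ => Real.sin (2 * (θ - μ)))
      (2 * Real.cos (2 * (θ - μ))) θ := fun θ => by
    refine (((hasDerivAt_id' θ).sub_const μ).const_mul 2).sin.congr_deriv ?_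
    ring
  have ibp := intervalIntegral.integral_mul_deriv_eq_deriv_mul_of_hasDerivAt
    (a := 0) (b := 2 * π) (u := fun θ => Real.sin (2 * (θ - μ)))
    (u' := fun θ => 2 * Real.cos (2 * (θ - μ))) (v := fun θ => G θ ^ β)
    (Continuous.continuousOn (by fun_prop)) hFcont.continuousOn (fun θ _ => hsder θ) hFder
    (Continuous.intervalIntegrable (by fun_prop) _ _) hfint
  have e1 : Real.sin (2 * (2 * π - μ)) = -Real.sin (2 * μ) := by
    rw [show 2 * (2 * π - μ) = -(2 * μ) + 2 * π + 2 * π by ring, Real.sin_add_two_pi,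
      Real.sin_add_two_pi, Real.sin_neg]
  simp only [hG0, hG1, e1, Real.one_rpow, Real.zero_rpow hβ.ne', mul_one, mul_zero, sub_zero] at ibp
  refine ibp.trans ?_
  congr 1
  simp only [mul_assoc, intervalIntegral.integral_const_mul]
  congr 1
  -- the series
  have hint' : ∀ k, ∀ s ∈ Finset.range (k + 1), IntegrableOn (v k s) (Set.Ioc 0 (2 * π)) volume :=
    fun k s hs => (integrableOn_Ioc_iff_integrableOn_Ioo (by simp)).2
      (hint k s (Nat.lt_succ_iff.1 (Finset.mem_range.1 hs)))
  have hSint : ∀ k, Integrable (fun θ => ∑ s ∈ Finset.range (k + 1), v k s θ)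
      (volume.restrict (Set.Ioc 0 (2 * π))) := fun k => integrable_finsetSum _ (hint' k)
  have hswap := hasSum_integral_of_summable_integral_norm
    (μ := volume.restrict (Set.Ioc 0 (2 * π)))
    (F := fun k θ => ∑ s ∈ Finset.range (k + 1), v k s θ) hSint (by
      refine Summable.of_nonneg_of_le (fun k => integral_nonneg fun _ => norm_nonneg _)
        (fun k => ?_) hsum
      simp only [intervalIntegral.integral_of_le h2π.le]
      rw [← integral_finsetSum _ fun s hs => (hint' k s hs).abs]
      refine integral_mono (hSint k).norm
        (integrable_finsetSum _ fun s hs => (hint' k s hs).abs) fun θ => ?_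
      exact Finset.abs_sum_le_sum_abs _ _)
  have hpt : ∀ θ ∈ Set.Ioc 0 (2 * π),
      ∑' k, ∑ s ∈ Finset.range (k + 1), v k s θ = Real.cos (2 * (θ - μ)) * G θ ^ β := by
    intro θ hθ
    have hb := ec_bound ρ μ θ hρ0 hρ1 hθ.1
    have hs := (ec_binom_hasSum' β _ _ hb).mul_left (Real.cos (2 * (θ - μ)))
    refine Eq.trans (tsum_congr fun k => ?_) hs.tsum_eq
    have hterm : ∀ s ∈ Finset.range (k + 1), v k s θ =
        genBinom β k * (θ / (2 * π)) ^ (β - (k : ℝ)) * (ρ / π) ^ k * Real.cos (2 * (θ - μ)) *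
        (if |Real.sin (θ - μ)| ≥ |Real.sin μ| then
          Real.sin μ ^ s * Real.sin (θ - μ) ^ (k - s) * (Nat.choose k s : ℝ)
          else Real.sin (θ - μ) ^ s * Real.sin μ ^ (k - s) * (Nat.choose k s : ℝ)) := by
      intro s hs
      rw [hv k s (Nat.lt_succ_iff.1 (Finset.mem_range.1 hs)), Real.cos_two_mul,
        show θ / (2 * π) = 1 / (2 * π) * θ by ring, Real.mul_rpow (by positivity) hθ.1.le]
      split_ifs <;> ring
    rw [Finset.sum_congr rfl hterm, ← Finset.mul_sum]
    have hbin : ∑ s ∈ Finset.range (k + 1), (if |Real.sin (θ - μ)| ≥ |Real.sin μ| then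
          Real.sin μ ^ s * Real.sin (θ - μ) ^ (k - s) * (Nat.choose k s : ℝ)
          else Real.sin (θ - μ) ^ s * Real.sin μ ^ (k - s) * (Nat.choose k s : ℝ)) =
        (Real.sin (θ - μ) + Real.sin μ) ^ k := by
      split_ifs
      · rw [add_comm (Real.sin (θ - μ)), add_pow]
      · rw [add_pow]
    rw [hbin, mul_pow]
    ring
  rw [intervalIntegral.integral_of_le h2π.le, ← setIntegral_congr_fun measurableSet_Ioc hpt,
    ← hswap.tsum_eq]
  refine tsum_congr fun k => ?_
  simp only [intervalIntegral.integral_of_le h2π.le]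
  exact integral_finsetSum _ (hint' k)
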